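/- arXiv:2405.06785 — 9 statements merged into one kernel-verified Lean document; each statement's English description precedes it below -/
import Mathlib

section
/- Let 𝒜 be a real tensor of order m ≥ 2 and dimension n ≥ 2. Suppose every proper principal subtensor of 𝒜 is semi-positive and 𝒜 has a nonnegative row-subtensor, i.e., there exists an index i such that a_{i i₂…i_m} ≥ 0 for all i₂,…,i_m ∈ {1,…,n}. Then 𝒜 is semi-positive. -/
/-- `(A x^{m-1})_i` for an order-`m = k+2`, dimension-`n` tensor `A`. -/
def tmul {n k : ℕ} (A : (Fin (k + 2) → Fin n) → ℝ) (x : Fin n → ℝ) (i : Fin n) : ℝ :=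
  ∑ f : Fin (k + 1) → Fin n, A (Fin.cons i f) * ∏ j, x (f j)

/-- `A` is semi-positive. -/
def SemiPos {n k : ℕ} (A : (Fin (k + 2) → Fin n) → ℝ) : Prop :=
  ∀ x : Fin n → ℝ, (∀ i, 0 ≤ x i) → x ≠ 0 → ∃ j, 0 < x j ∧ 0 ≤ tmul A x j

/-- The principal subtensor of `A` indexed by `J` is semi-positive (expressed via
vectors supported on `J`). -/
def SemiPosOn {n k : ℕ} (A : (Fin (k + 2) → Fin n) → ℝ) (J : Finset (Fin n)) : Prop :=
  ∀ x : Fin n → ℝ, (∀ i, 0 ≤ x i) → (∀ i, i ∉ J → x i = 0) → x ≠ 0 →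
    ∃ j, 0 < x j ∧ 0 ≤ tmul A x j

/-- if every proper principal subtensor of `A` is semi-positive and `A` has a
nonnegative row-subtensor, then `A` is semi-positive. -/
theorem stmt_2 {n k : ℕ} (hn : 2 ≤ n) (A : (Fin (k + 2) → Fin n) → ℝ)
    (hsub : ∀ J : Finset (Fin n), J.Nonempty → J ≠ Finset.univ → SemiPosOn A J)
    (hrow : ∃ i : Fin n, ∀ f : Fin (k + 1) → Fin n, 0 ≤ A (Fin.cons i f)) :
    SemiPos A := by
  intro x hx hx0
  obtain ⟨i, hi⟩ := hrow
  rcases (hx i).lt_or_eq with h | h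
  · exact ⟨i, h, Finset.sum_nonneg fun f _ =>
      mul_nonneg (hi f) (Finset.prod_nonneg fun j _ => hx (f j))⟩
  · have : Nontrivial (Fin n) := Fin.nontrivial_iff_two_le.mpr hn
    obtain ⟨j, hj⟩ := exists_ne i
    refine hsub (Finset.univ.erase i) ⟨j, by simp [hj]⟩ (by simp) x hx ?_ hx0
    intro l hl
    obtain rfl : l = i := by simpa using hl
    exact h.symm
end

section
/- Let 𝒜 be a real tensor of order m ≥ 2 and dimension n ≥ 2. Suppose every proper principal subtensor of 𝒜 is strictly semi-positive and 𝒜 has a positive row-subtensor, i.e., there exists an index i such that a_{i i₂…i_m} > 0 for all i₂,…,i_m ∈ {1,…,n}. Then 𝒜 is strictly semi-positive. -/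
/-- `A` is strictly semi-positive. -/
def StrictSemiPos {n k : ℕ} (A : (Fin (k + 2) → Fin n) → ℝ) : Prop :=
  ∀ x : Fin n → ℝ, (∀ i, 0 ≤ x i) → x ≠ 0 → ∃ j, 0 < x j ∧ 0 < tmul A x j

/-- The principal subtensor of `A` indexed by `J` is strictly semi-positive. -/
def StrictSemiPosOn {n k : ℕ} (A : (Fin (k + 2) → Fin n) → ℝ) (J : Finset (Fin n)) : Prop :=
  ∀ x : Fin n → ℝ, (∀ i, 0 ≤ x i) → (∀ i, i ∉ J → x i = 0) → x ≠ 0 →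
    ∃ j, 0 < x j ∧ 0 < tmul A x j

/-- if every proper principal subtensor of `A` is strictly semi-positive and
`A` has a positive row-subtensor, then `A` is strictly semi-positive. -/
theorem stmt_3 {n k : ℕ} (hn : 2 ≤ n) (A : (Fin (k + 2) → Fin n) → ℝ)
    (hsub : ∀ J : Finset (Fin n), J.Nonempty → J ≠ Finset.univ → StrictSemiPosOn A J)
    (hrow : ∃ i : Fin n, ∀ f : Fin (k + 1) → Fin n, 0 < A (Fin.cons i f)) :
    StrictSemiPos A := by
  intro x hx hx0
  by_cases hpos : ∀ i, 0 < x i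
  · obtain ⟨i, hi⟩ := hrow
    refine ⟨i, hpos i, Finset.sum_pos (fun f _ => ?_) ⟨fun _ => i, Finset.mem_univ _⟩⟩
    exact mul_pos (hi f) (Finset.prod_pos fun j _ => hpos (f j))
  · push Not at hpos
    obtain ⟨i, hi⟩ := hpos
    obtain ⟨j, hj⟩ := Function.ne_iff.mp hx0
    refine hsub (Finset.univ.erase i) ⟨j, ?_⟩ ?_ x hx ?_ hx0
    · refine Finset.mem_erase.mpr ⟨?_, Finset.mem_univ j⟩
      rintro rfl
      exact hj (le_antisymm hi (hx j))
    · exact (Finset.erase_ssubset (Finset.mem_univ i)).ne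
    · intro l hl
      obtain rfl : l = i := by simpa using hl
      exact le_antisymm hi (hx l)
end

section
/- Let 𝒜 be a real tensor of order m ≥ 2 and dimension n ≥ 1 such that all diagonal entries a_{ii…i} are nonnegative and 𝒜 is diagonally dominant. Then 𝒜 is semi-positive. -/
/-- If `x` is nonnegative and maximal at `i`, and row `i` of `A` is diagonally dominant with a
nonnegative diagonal entry, then `(A x^{m-1})_i` is nonnegative. -/
theorem tmul_nonneg_of_forall_le {n k : ℕ} (A : (Fin (k + 2) → Fin n) → ℝ)
    (x : Fin n → ℝ) (i : Fin n) (hdiag : 0 ≤ A (fun _ => i))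
    (hdd : ∑ f ∈ Finset.univ.filter (fun f : Fin (k + 1) → Fin n => f ≠ fun _ => i),
        |A (Fin.cons i f)| ≤ |A (fun _ => i)|)
    (hx : ∀ j, 0 ≤ x j) (hmax : ∀ j, x j ≤ x i) : 0 ≤ tmul A x i := by
  have hcons : (Fin.cons i (fun _ : Fin (k + 1) => i) : Fin (k + 2) → Fin n) = fun _ => i := by
    funext j
    refine Fin.cases ?_ (fun _ => ?_) j <;> simp
  have hterm : ∀ f : Fin (k + 1) → Fin n,
      -(|A (Fin.cons i f)| * x i ^ (k + 1)) ≤ A (Fin.cons i f) * ∏ j, x (f j) := by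
    intro f
    have hprod : ∏ j, x (f j) ≤ x i ^ (k + 1) := by
      simpa using Finset.prod_le_prod (s := Finset.univ) (fun j _ => hx (f j))
        (fun j _ => hmax (f j))
    have hprod_nonneg : 0 ≤ ∏ j, x (f j) := Finset.prod_nonneg fun j _ => hx (f j)
    calc -(|A (Fin.cons i f)| * x i ^ (k + 1))
        ≤ -(|A (Fin.cons i f)| * ∏ j, x (f j)) := by gcongr
      _ = -|A (Fin.cons i f)| * ∏ j, x (f j) := by ring
      _ ≤ A (Fin.cons i f) * ∏ j, x (f j) := by
        gcongr
        exact neg_abs_le _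
  have hsum := Finset.sum_le_sum
    (s := Finset.univ.filter fun f : Fin (k + 1) → Fin n => f ≠ fun _ => i)
    fun f _ => hterm f
  rw [Finset.sum_neg_distrib, ← Finset.sum_mul] at hsum
  rw [abs_of_nonneg hdiag] at hdd
  have hdom := mul_le_mul_of_nonneg_right hdd (pow_nonneg (hx i) (k + 1))
  have hsplit : tmul A x i = A (fun _ => i) * x i ^ (k + 1) +
      ∑ f ∈ Finset.univ.filter (fun f : Fin (k + 1) → Fin n => f ≠ fun _ => i),
        A (Fin.cons i f) * ∏ j, x (f j) := by
    rw [tmul, Finset.filter_ne' Finset.univ,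
      ← Finset.add_sum_erase _ _ (Finset.mem_univ fun _ => i), hcons]
    simp
  linarith

/-- a diagonally dominant tensor with nonnegative diagonal entries is
semi-positive. -/
theorem stmt_4 {n k : ℕ} (hn : 1 ≤ n) (A : (Fin (k + 2) → Fin n) → ℝ)
    (hdiag : ∀ i : Fin n, 0 ≤ A (fun _ => i))
    (hdd : ∀ i : Fin n,
      ∑ f ∈ Finset.univ.filter (fun f : Fin (k + 1) → Fin n => f ≠ fun _ => i),
        |A (Fin.cons i f)| ≤ |A (fun _ => i)|) :
    SemiPos A := by
  intro x hx hx0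
  have : Nonempty (Fin n) := ⟨⟨0, hn⟩⟩
  obtain ⟨i, hmax⟩ := Finite.exists_max x
  refine ⟨i, ?_, tmul_nonneg_of_forall_le A x i (hdiag i) (hdd i) hx hmax⟩
  obtain ⟨j, hj⟩ := Function.ne_iff.mp hx0
  exact ((hx j).lt_of_ne' hj).trans_le (hmax j)
end

section
/- Let 𝒜 be a real tensor of order m ≥ 2 and dimension n ≥ 1 such that all diagonal entries a_{ii…i} are positive and 𝒜 is strictly diagonally dominant. Then 𝒜 is strictly semi-positive. -/
theorem prod_comp_le_pow {n d : ℕ} {x : Fin n → ℝ} {i : Fin n} (hx : ∀ j, 0 ≤ x j)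
    (hi : ∀ j, x j ≤ x i) (f : Fin d → Fin n) : ∏ j, x (f j) ≤ x i ^ d := by
  simpa using Finset.prod_le_prod (s := Finset.univ) (fun j _ => hx (f j)) (fun j _ => hi (f j))

/-- At an index where a nonnegative vector `x` is maximal, `A x^{m-1}` is at least the
diagonal excess of that row times `x i ^ (m-1)`. -/
theorem diag_sub_sum_abs_mul_pow_le_tmul {n k : ℕ} (A : (Fin (k + 2) → Fin n) → ℝ)
    {x : Fin n → ℝ} {i : Fin n} (hx : ∀ j, 0 ≤ x j) (hi : ∀ j, x j ≤ x i) :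
    (A (fun _ => i) - ∑ f ∈ Finset.univ.filter (fun f : Fin (k + 1) → Fin n => f ≠ fun _ => i),
      |A (Fin.cons i f)|) * x i ^ (k + 1) ≤ tmul A x i := by
  have hcons : (Fin.cons i (fun _ => i) : Fin (k + 2) → Fin n) = fun _ => i :=
    Fin.cons_self_tail (fun _ : Fin (k + 2) => i)
  have hsplit : tmul A x i = A (fun _ => i) * x i ^ (k + 1) +
      ∑ f ∈ Finset.univ.filter (fun f : Fin (k + 1) → Fin n => f ≠ fun _ => i),
        A (Fin.cons i f) * ∏ j, x (f j) := by
    rw [tmul, ← Finset.add_sum_erase _ _ (Finset.mem_univ fun _ => i), Finset.filter_ne',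
      hcons, Fin.prod_const]
  rw [hsplit, sub_mul, sub_eq_add_neg, Finset.sum_mul, ← Finset.sum_neg_distrib]
  gcongr with f
  have hprod : 0 ≤ ∏ j, x (f j) := Finset.prod_nonneg fun j _ => hx (f j)
  calc -(|A (Fin.cons i f)| * x i ^ (k + 1))
      ≤ -(|A (Fin.cons i f)| * ∏ j, x (f j)) :=
        neg_le_neg (mul_le_mul_of_nonneg_left (prod_comp_le_pow hx hi f) (abs_nonneg _))
    _ = -|A (Fin.cons i f)| * ∏ j, x (f j) := (neg_mul _ _).symm
    _ ≤ A (Fin.cons i f) * ∏ j, x (f j) :=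
        mul_le_mul_of_nonneg_right (neg_abs_le _) hprod

/-- a strictly diagonally dominant tensor with positive diagonal entries is
strictly semi-positive. -/
theorem stmt_5 {n k : ℕ} (hn : 1 ≤ n) (A : (Fin (k + 2) → Fin n) → ℝ)
    (hdiag : ∀ i : Fin n, 0 < A (fun _ => i))
    (hdd : ∀ i : Fin n,
      ∑ f ∈ Finset.univ.filter (fun f : Fin (k + 1) → Fin n => f ≠ fun _ => i),
        |A (Fin.cons i f)| < |A (fun _ => i)|) :
    StrictSemiPos A := by
  intro x hx hx0
  obtain ⟨l, hl⟩ := Function.ne_iff.mp hx0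
  have : Nonempty (Fin n) := ⟨l⟩
  obtain ⟨i, hi⟩ := Finite.exists_max x
  have hpos : 0 < x i := ((hx l).lt_of_ne' hl).trans_le (hi l)
  have hdom := hdd i
  rw [abs_of_pos (hdiag i)] at hdom
  exact ⟨i, hpos, (mul_pos (sub_pos.mpr hdom) (pow_pos hpos _)).trans_le
    (diag_sub_sum_abs_mul_pow_le_tmul A hx hi)⟩
end

section
/- Let 𝒜 = (a_{i₁…i_m}) be an almost semi-positive real tensor of order m ≥ 2 and dimension n ≥ 2. Then (a) every diagonal entry satisfies a_{ii…i} ≥ 0 for all i ∈ {1,…,n}, and (b) there exists an index k ∈ {1,…,n} such that a_{kk…k} + Σ a_{k i₂…i_m} < 0, where the sum runs over all index tuples (i₂,…,i_m) ≠ (k,…,k) with a_{k i₂…i_m} < 0. -/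
/-- `A` is almost semi-positive. -/
def AlmostSemiPos {n k : ℕ} (A : (Fin (k + 2) → Fin n) → ℝ) : Prop :=
  (∀ J : Finset (Fin n), J.Nonempty → J ≠ Finset.univ → SemiPosOn A J) ∧
    ∃ x : Fin n → ℝ, (∀ i, 0 < x i) ∧ ∀ i, tmul A x i < 0

lemma cons_const_eq {α : Type*} {k : ℕ} (i : α) :
    (Fin.cons i (fun _ => i : Fin (k + 1) → α) : Fin (k + 2) → α) = fun _ => i := by
  funext t
  refine Fin.cases ?_ (fun s => ?_) t <;> simp

/-- At the `i`-th unit vector, the `i`-th coordinate of `A x^{m-1}` is a diagonal entry. -/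
lemma tmul_single {n k : ℕ} (A : (Fin (k + 2) → Fin n) → ℝ) (i : Fin n) :
    tmul A (Pi.single i 1) i = A (fun _ => i) := by
  unfold tmul
  rw [Finset.sum_eq_single (fun _ => i), cons_const_eq]
  · simp
  · intro f _ hf
    obtain ⟨t, ht⟩ := Function.ne_iff.mp hf
    rw [Finset.prod_eq_zero (Finset.mem_univ t) (Pi.single_eq_of_ne ht _), mul_zero]
  · simp

/-- At an index where a nonnegative vector is maximal, `A x^{m-1}` is bounded below by the
diagonal entry plus the negative off-diagonal entries, scaled by a power of the maximum. -/
lemma le_tmul_of_forall_le {n k : ℕ} (A : (Fin (k + 2) → Fin n) → ℝ) {x : Fin n → ℝ}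
    (hx : ∀ i, 0 ≤ x i) {j : Fin n} (hj : ∀ i, x i ≤ x j) :
    (A (fun _ => j) +
      ∑ f ∈ Finset.univ.filter
          (fun f : Fin (k + 1) → Fin n => f ≠ (fun _ => j) ∧ A (Fin.cons j f) < 0),
        A (Fin.cons j f)) * x j ^ (k + 1) ≤ tmul A x j := by
  unfold tmul
  rw [← Finset.add_sum_erase _ _ (Finset.mem_univ (fun _ => j)), cons_const_eq, add_mul,
    Finset.sum_mul]
  refine add_le_add (by simp) ?_
  rw [← Finset.filter_filter, Finset.filter_ne', Finset.sum_filter]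
  refine Finset.sum_le_sum fun f _ => ?_
  have h0 : 0 ≤ ∏ t, x (f t) := Finset.prod_nonneg fun t _ => hx _
  split_ifs with h
  · refine mul_le_mul_of_nonpos_left ?_ h.le
    calc ∏ t, x (f t) ≤ ∏ _t : Fin (k + 1), x j :=
          Finset.prod_le_prod (fun t _ => hx _) fun t _ => hj _
      _ = x j ^ (k + 1) := by simp
  · exact mul_nonneg (not_lt.mp h) h0

/-- entrywise properties of almost semi-positive tensors. -/
theorem stmt_8 {n k : ℕ} (hn : 2 ≤ n) (A : (Fin (k + 2) → Fin n) → ℝ)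
    (hA : AlmostSemiPos A) :
    (∀ i : Fin n, 0 ≤ A (fun _ => i)) ∧
      ∃ j : Fin n,
        A (fun _ => j) +
          ∑ f ∈ Finset.univ.filter
              (fun f : Fin (k + 1) → Fin n => f ≠ (fun _ => j) ∧ A (Fin.cons j f) < 0),
            A (Fin.cons j f) < 0 := by
  obtain ⟨hJ, x, hx, hneg⟩ := hA
  constructor
  · intro i
    have hi : ({i} : Finset (Fin n)) ≠ Finset.univ := by
      intro h
      have := congrArg Finset.card h
      simp at this
      omega
    obtain ⟨j, hj, hj'⟩ := hJ {i} (Finset.singleton_nonempty i) hi (Pi.single i 1)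
      (fun t => (Pi.single_nonneg.mpr zero_le_one : (0 : Fin n → ℝ) ≤ Pi.single i 1) t)
      (fun t ht => Pi.single_eq_of_ne (by simpa using ht) _) (by simp)
    have hji : j = i := by
      by_contra h
      simp [Pi.single_eq_of_ne h] at hj
    subst hji
    rwa [tmul_single] at hj'
  · have : Nonempty (Fin n) := ⟨⟨0, by omega⟩⟩
    obtain ⟨j, hj⟩ := Finite.exists_max x
    have h := (le_tmul_of_forall_le A (fun i => (hx i).le) hj).trans_lt (hneg j)
    exact ⟨j, neg_of_mul_neg_left h (pow_nonneg (hx j).le _)⟩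
end

section
/- Let 𝒜 be a real tensor of order m ≥ 2 and dimension n ≥ 2, and let D = diag(d₁,…,dₙ) be a diagonal matrix with all diagonal entries d_i > 0. Then the following are equivalent: (i) 𝒜 is almost semi-positive; (ii) D𝒜 is almost semi-positive; (iii) 𝒜D is almost semi-positive. Here D𝒜 is the tensor with entries d_{i₁} a_{i₁ i₂…i_m} and 𝒜D is the tensor with entries a_{i₁ i₂…i_m} d_{i₂} d_{i₃} ⋯ d_{i_m}. -/
/-- Almost semi-positivity is inherited along a positive rescaling of the argument and of the
value of `x ↦ A x^{m-1}`. -/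
theorem AlmostSemiPos.of_tmul_eq {n k : ℕ} {A B : (Fin (k + 2) → Fin n) → ℝ} {c e : Fin n → ℝ}
    (hc : ∀ i, 0 < c i) (he : ∀ i, 0 < e i)
    (h : ∀ x i, tmul B x i = c i * tmul A (e * x) i) (hA : AlmostSemiPos A) :
    AlmostSemiPos B := by
  obtain ⟨hsub, x, hx, hneg⟩ := hA
  refine ⟨fun J hJ hJ' y hy hyJ hy0 => ?_, e⁻¹ * x, fun i => ?_, fun i => ?_⟩
  · obtain ⟨j, hj, hAj⟩ := hsub J hJ hJ' (e * y) (fun i => mul_nonneg (he i).le (hy i))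
      (fun i hi => by simp [hyJ i hi]) (fun h0 => hy0 (funext fun i =>
        (mul_eq_zero.mp (congrFun h0 i)).resolve_left (he i).ne'))
    refine ⟨j, (mul_pos_iff_of_pos_left (he j)).mp hj, ?_⟩
    rw [h]
    exact mul_nonneg (hc j).le hAj
  · exact mul_pos (inv_pos.mpr (he i)) (hx i)
  · have hex : e * (e⁻¹ * x) = x := funext fun i => mul_inv_cancel_left₀ (he i).ne' (x i)
    rw [h, hex]
    exact mul_neg_of_pos_of_neg (hc i) (hneg i)

theorem almostSemiPos_iff_of_tmul_eq {n k : ℕ} {A B : (Fin (k + 2) → Fin n) → ℝ}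
    {c e : Fin n → ℝ} (hc : ∀ i, 0 < c i) (he : ∀ i, 0 < e i)
    (h : ∀ x i, tmul B x i = c i * tmul A (e * x) i) :
    AlmostSemiPos A ↔ AlmostSemiPos B := by
  refine ⟨.of_tmul_eq hc he h, .of_tmul_eq (c := c⁻¹) (e := e⁻¹)
    (fun i => inv_pos.mpr (hc i)) (fun i => inv_pos.mpr (he i)) fun x i => ?_⟩
  have hex : e * (e⁻¹ * x) = x := funext fun i => mul_inv_cancel_left₀ (he i).ne' (x i)
  rw [h, hex, Pi.inv_apply, inv_mul_cancel_left₀ (hc i).ne']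

theorem tmul_diag_mul {n k : ℕ} (A : (Fin (k + 2) → Fin n) → ℝ) (d x : Fin n → ℝ) (i : Fin n) :
    tmul (fun g => d (g 0) * A g) x i = d i * tmul A x i := by
  simp [tmul, Finset.mul_sum, mul_assoc]

theorem tmul_mul_diag {n k : ℕ} (A : (Fin (k + 2) → Fin n) → ℝ) (d x : Fin n → ℝ) (i : Fin n) :
    tmul (fun g => A g * ∏ j : Fin (k + 1), d (g j.succ)) x i = tmul A (d * x) i := by
  simp [tmul, Finset.prod_mul_distrib, mul_assoc]

/-- for a positive diagonal matrix `D = diag d`, the tensors `A`, `DA` and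
`AD` are simultaneously almost semi-positive. -/
theorem stmt_11 {n k : ℕ} (hn : 2 ≤ n) (A : (Fin (k + 2) → Fin n) → ℝ)
    (d : Fin n → ℝ) (hd : ∀ i, 0 < d i) :
    (AlmostSemiPos A ↔ AlmostSemiPos (fun g => d (g 0) * A g)) ∧
      (AlmostSemiPos A ↔
        AlmostSemiPos (fun g => A g * ∏ j : Fin (k + 1), d (g j.succ))) := by
  exact ⟨almostSemiPos_iff_of_tmul_eq (e := 1) hd (fun _ => one_pos) fun x i => by
      rw [one_mul, tmul_diag_mul],
    almostSemiPos_iff_of_tmul_eq (c := 1) (fun _ => one_pos) hd fun x i => by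
      rw [Pi.one_apply, one_mul, tmul_mul_diag]⟩
end

section
/- Let 𝒜 be a real tensor of order m ≥ 2 and dimension n ≥ 2 such that every proper principal subtensor of 𝒜 is semi-positive. Then 𝒜 is almost semi-positive if and only if there exists a diagonal tensor 𝒟 of order m and dimension n with all diagonal entries positive and a vector x > 0 in ℝⁿ such that (𝒜 + 𝒟)x^{m−1} = 0. -/
/-- `D` is a diagonal tensor: entries with not-all-equal indices vanish. -/
def IsDiagTensor {n k : ℕ} (D : (Fin (k + 2) → Fin n) → ℝ) : Prop :=
  ∀ g : Fin (k + 2) → Fin n, (∃ j j', g j ≠ g j') → D g = 0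

theorem tmul_add {n k : ℕ} (A D : (Fin (k + 2) → Fin n) → ℝ) (x : Fin n → ℝ) (i : Fin n) :
    tmul (fun g => A g + D g) x i = tmul A x i + tmul D x i := by
  simp only [tmul, add_mul, Finset.sum_add_distrib]

theorem IsDiagTensor.tmul_eq {n k : ℕ} {D : (Fin (k + 2) → Fin n) → ℝ} (hD : IsDiagTensor D)
    (x : Fin n → ℝ) (i : Fin n) : tmul D x i = D (fun _ => i) * x i ^ (k + 1) := by
  have hcons : (Fin.cons i (fun _ => i) : Fin (k + 2) → Fin n) = fun _ => i := by
    ext j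
    refine Fin.cases ?_ (fun j => ?_) j <;> simp
  unfold tmul
  rw [Finset.sum_eq_single (fun _ => i)]
  · rw [hcons]
    simp
  · intro f _ hf
    obtain ⟨j, hj⟩ := Function.ne_iff.mp hf
    rw [hD _ ⟨j.succ, 0, by simpa using hj⟩, zero_mul]
  · simp

/-- if every proper principal subtensor of `A` is semi-positive, then `A` is
almost semi-positive iff `A + D` has a positive null vector for some diagonal tensor `D`
with positive diagonal entries. -/
theorem stmt_14 {n k : ℕ} (hn : 2 ≤ n) (A : (Fin (k + 2) → Fin n) → ℝ)
    (hsub : ∀ J : Finset (Fin n), J.Nonempty → J ≠ Finset.univ → SemiPosOn A J) :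
    AlmostSemiPos A ↔
      ∃ D : (Fin (k + 2) → Fin n) → ℝ, IsDiagTensor D ∧ (∀ i : Fin n, 0 < D (fun _ => i)) ∧
        ∃ x : Fin n → ℝ, (∀ i, 0 < x i) ∧ ∀ i, tmul (fun g => A g + D g) x i = 0 := by
  constructor
  · rintro ⟨-, x, hx, hneg⟩
    set D : (Fin (k + 2) → Fin n) → ℝ := fun g =>
      if ∀ j, g j = g 0 then -tmul A x (g 0) / x (g 0) ^ (k + 1) else 0 with hDdef
    have hD : IsDiagTensor D := by
      rintro g ⟨j, j', hne⟩
      exact if_neg fun h => hne ((h j).trans (h j').symm)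
    have hDi (i : Fin n) : D (fun _ => i) = -tmul A x i / x i ^ (k + 1) := by simp [hDdef]
    refine ⟨D, hD, fun i => ?_, x, hx, fun i => ?_⟩
    · rw [hDi]
      exact div_pos (neg_pos.mpr (hneg i)) (pow_pos (hx i) _)
    · rw [tmul_add, hD.tmul_eq, hDi, div_mul_cancel₀ _ (pow_pos (hx i) _).ne', add_neg_cancel]
  · rintro ⟨D, hD, hpos, x, hx, hzero⟩
    refine ⟨hsub, x, hx, fun i => ?_⟩
    have h := hzero i
    rw [tmul_add, hD.tmul_eq] at h
    linarith [mul_pos (hpos i) (pow_pos (hx i) (k + 1))]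
end

section
/- Let 𝒜 be an almost semi-positive real tensor of order m ≥ 2 and dimension n ≥ 2. Then there exists a diagonal tensor 𝒟 of order m and dimension n with all diagonal entries positive such that 𝒜 + 𝒟 is both almost strictly semi-positive and a completely S₀-tensor. -/
/-- `A` is almost strictly semi-positive. -/
def AlmostStrictSemiPos {n k : ℕ} (A : (Fin (k + 2) → Fin n) → ℝ) : Prop :=
  (∀ J : Finset (Fin n), J.Nonempty → J ≠ Finset.univ → StrictSemiPosOn A J) ∧
    ∃ x : Fin n → ℝ, (∀ i, 0 < x i) ∧ ∀ i, tmul A x i ≤ 0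

/-- The principal subtensor of `A` indexed by `J` is an S₀-tensor. -/
def SZeroOn {n k : ℕ} (A : (Fin (k + 2) → Fin n) → ℝ) (J : Finset (Fin n)) : Prop :=
  ∃ x : Fin n → ℝ, (∀ i, 0 ≤ x i) ∧ (∀ i, i ∉ J → x i = 0) ∧ x ≠ 0 ∧
    ∀ j ∈ J, 0 ≤ tmul A x j

/-- `A` is a completely S₀-tensor: every principal subtensor (including `A` itself) is an
S₀-tensor. -/
def CompletelySZero {n k : ℕ} (A : (Fin (k + 2) → Fin n) → ℝ) : Prop :=
  ∀ J : Finset (Fin n), J.Nonempty → SZeroOn A J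

theorem Finset.exists_image_erase_eq_iff {α β : Type*} [DecidableEq α] [DecidableEq β]
    {s : Finset α} {f : α → β} (h : s.card = (s.image f).card + 1) {a : α} (ha : a ∈ s)
    (hea : (s.erase a).image f = s.image f) :
    ∃ b ∈ s, b ≠ a ∧ f b = f a ∧
      ∀ x ∈ s, (s.erase x).image f = s.image f ↔ x = a ∨ x = b := by
  have hfa : f a ∈ (s.erase a).image f := hea ▸ mem_image_of_mem f ha
  obtain ⟨b, hb, hfb⟩ := mem_image.1 hfa
  rw [mem_erase] at hb
  refine ⟨b, hb.2, hb.1, hfb, fun x hx => ⟨fun hex => ?_, ?_⟩⟩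
  · by_contra! hne
    have hinj : Set.InjOn f (s.erase x) := by
      rw [← card_image_iff, hex, card_erase_of_mem hx]
      omega
    exact hb.1 (hinj (by simp [hb.2, hne.2.symm]) (by simp [ha, hne.1.symm]) hfb)
  · rintro (rfl | rfl)
    · exact hea
    · refine (image_subset_image (erase_subset _ _)).antisymm fun y hy => ?_
      obtain ⟨z, hz, rfl⟩ := mem_image.1 hy
      by_cases hzx : z = x
      · rw [hzx, hfb]
        exact mem_image_of_mem f (mem_erase.2 ⟨hb.1.symm, ha⟩)
      · exact mem_image_of_mem f (mem_erase.2 ⟨hzx, hz⟩)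

theorem Finset.exists_image_erase_eq {α β : Type*} [DecidableEq α] [DecidableEq β]
    {s : Finset α} {f : α → β} (h : s.card = (s.image f).card + 1) :
    ∃ a ∈ s, (s.erase a).image f = s.image f := by
  have hn : ¬ Set.InjOn f s := fun hinj => by rw [card_image_of_injOn hinj] at h; omega
  simp only [Set.InjOn, not_forall] at hn
  obtain ⟨a, ha, b, hb, hab, hne⟩ := hn
  refine ⟨a, ha, (image_subset_image (erase_subset _ _)).antisymm fun y hy => ?_⟩
  obtain ⟨z, hz, rfl⟩ := mem_image.1 hy
  by_cases hza : z = a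
  · rw [hza, hab]
    exact mem_image_of_mem f (mem_erase.2 ⟨Ne.symm hne, hb⟩)
  · exact mem_image_of_mem f (mem_erase.2 ⟨hza, hz⟩)

/-- `σ` is dominant for the orders `r i` if no point exceeds the `r i`-minimum of `σ` for every `i`. -/
def Dominant {X ι : Type*} (r : ι → X → ℕ) (σ : Finset X) : Prop :=
  ∀ y, ∃ i, ∀ x ∈ σ, r i y ≤ r i x

/-- `z` is `r a`-maximal among the points exceeding `m j` in the order `r j` for every `j ≠ a`. -/
def IsPivot {X ι : Type*} (r : ι → X → ℕ) (m : ι → X) (a : ι) (z : X) : Prop :=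
  (∀ j, j ≠ a → r j (m j) < r j z) ∧
    ∀ y, (∀ j, j ≠ a → r j (m j) < r j y) → r a y ≤ r a z

section Scarf

variable {X ι : Type*} {r : ι → X → ℕ}

theorem exists_min_on (r : ι → X → ℕ) {δ : Finset X} (h : δ.Nonempty) :
    ∃ m : ι → X, (∀ i, m i ∈ δ) ∧ ∀ i, ∀ x ∈ δ, r i (m i) ≤ r i x := by
  choose m hm hmin using fun i => Finset.exists_min_image δ (r i) h
  exact ⟨m, hm, hmin⟩

theorem Dominant.mono {σ τ : Finset X} (h : σ ⊆ τ) (hτ : Dominant r τ) :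
    Dominant r σ := fun y => (hτ y).imp fun _ hi x hx => hi x (h hx)

theorem IsPivot.eq (hr : ∀ i, Function.Injective (r i)) {m : ι → X} {a : ι} {z w : X}
    (hz : IsPivot r m a z) (hw : IsPivot r m a w) : z = w :=
  hr a (le_antisymm (hw.2 z hz.1) (hz.2 w hw.1))

theorem exists_isPivot [Finite X] {m : ι → X} {a : ι} {z : X}
    (hz : ∀ j, j ≠ a → r j (m j) < r j z) : ∃ w, IsPivot r m a w := by
  obtain ⟨w, hw, hmax⟩ := Set.exists_max_image {y | ∀ j, j ≠ a → r j (m j) < r j y} (r a)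
    (Set.toFinite _) ⟨z, hz⟩
  exact ⟨w, hw, hmax⟩

variable [Fintype ι] [DecidableEq X]

theorem Dominant.image_min (hr : ∀ i, Function.Injective (r i)) {δ : Finset X} (hδ : Dominant r δ)
    {m : ι → X} (hm : ∀ i, m i ∈ δ) (hmin : ∀ i, ∀ x ∈ δ, r i (m i) ≤ r i x) :
    Finset.univ.image m = δ := by
  ext x
  simp only [Finset.mem_image, Finset.mem_univ, true_and]
  refine ⟨by rintro ⟨i, rfl⟩; exact hm i, fun hx => ?_⟩
  obtain ⟨i, hi⟩ := hδ x
  exact ⟨i, hr i (le_antisymm (hmin i x hx) (hi _ (hm i)))⟩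

variable [DecidableEq ι]

theorem dominant_insert_iff (hr : ∀ i, Function.Injective (r i)) {δ : Finset X}
    (hδ : Dominant r δ) (hcard : δ.card + 1 = Fintype.card ι) {m : ι → X} (hm : ∀ i, m i ∈ δ)
    (hmin : ∀ i, ∀ x ∈ δ, r i (m i) ≤ r i x) (z : X) :
    (z ∉ δ ∧ Dominant r (insert z δ)) ↔
      ∃ i, (Finset.univ.erase i).image m = δ ∧ IsPivot r m i z := by
  constructor
  · rintro ⟨hz, hdom⟩
    have key : ∀ x ∈ δ, ∃ j, r j x < r j z ∧ m j = x := fun x hx => by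
      obtain ⟨j, hj⟩ := hdom x
      refine ⟨j, lt_of_le_of_ne (hj z (by simp)) fun h => hz (hr j h ▸ hx), ?_⟩
      exact hr j (le_antisymm (hmin j x hx) (hj _ (by simp [hm])))
    obtain ⟨i, hi⟩ := hdom z
    refine ⟨i, ?_, fun j hji => ?_, fun y hy => ?_⟩
    · ext x
      simp only [Finset.mem_image, Finset.mem_erase, Finset.mem_univ, and_true]
      refine ⟨by rintro ⟨j, -, rfl⟩; exact hm j, fun hx => ?_⟩
      obtain ⟨j, hj, hjx⟩ := key x hx
      refine ⟨j, ?_, hjx⟩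
      rintro rfl
      exact absurd (hi x (by simp [hx])) (by omega)
    · by_contra! hle
      have hsub : δ ⊆ ((Finset.univ.erase i).erase j).image m := fun x hx => by
        obtain ⟨l, hl, hlx⟩ := key x hx
        refine Finset.mem_image.2 ⟨l, ?_, hlx⟩
        simp only [Finset.mem_erase, Finset.mem_univ, and_true]
        constructor
        · rintro rfl
          have := hmin l x hx
          omega
        · rintro rfl
          exact absurd (hi x (by simp [hx])) (by omega)
      have h1 := (Finset.card_le_card hsub).trans Finset.card_image_le
      have h2 : 0 < (Finset.univ.erase i).card := Finset.card_pos.2 ⟨j, by simp [hji]⟩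
      rw [Finset.card_erase_of_mem (by simp [hji])] at h1
      rw [Finset.card_erase_of_mem (by simp), Finset.card_univ] at h1 h2
      omega
    · obtain ⟨l, hl⟩ := hdom y
      by_cases hli : l = i
      · exact hli ▸ hl z (by simp)
      · exact absurd (hl (m l) (by simp [hm])) (by simpa using hy l hli)
  · rintro ⟨i, himg, hz, hmax⟩
    constructor
    · intro hzδ
      rw [← himg] at hzδ
      obtain ⟨j, hj, rfl⟩ := Finset.mem_image.1 hzδ
      exact (hz j (by simpa using hj)).false
    · intro y
      by_cases hy : ∀ j, j ≠ i → r j (m j) < r j y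
      · obtain ⟨l, hl⟩ := hδ y
        have hli : l = i := by
          by_contra hli
          exact absurd (hl (m l) (hm l)) (by simpa using hy l hli)
        subst hli
        exact ⟨l, by simpa using ⟨hmax y hy, hl⟩⟩
      · push Not at hy
        obtain ⟨j, hji, hj⟩ := hy
        exact ⟨j, by simpa using ⟨hj.trans (hz j hji).le, fun x hx => hj.trans (hmin j x hx)⟩⟩

variable [Fintype X]

open Classical in
/-- The dominant sets with as many points as there are orders. -/
noncomputable def rooms (r : ι → X → ℕ) : Finset (Finset X) :=
  {τ | τ.card = Fintype.card ι ∧ Dominant r τ}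

open Classical in
/-- The dominant sets, one point short of a room, that carry every colour but `i₀` once. -/
noncomputable def doors (r : ι → X → ℕ) (c : X → ι) (i₀ : ι) : Finset (Finset X) :=
  {δ | δ.card + 1 = Fintype.card ι ∧ Dominant r δ ∧ δ.image c = Finset.univ.erase i₀}

theorem even_card_doors_below {c : X → ι} {i₀ : ι} {τ : Finset X} (hτ : τ ∈ rooms r)
    (hc : τ.image c ≠ Finset.univ) : Even ((doors r c i₀).filter (· ⊆ τ)).card := by
  classical
  simp only [rooms, Finset.mem_filter_univ] at hτ
  have herase : (Finset.univ.erase i₀).card + 1 = Fintype.card ι := by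
    rw [Finset.card_erase_add_one (Finset.mem_univ _), Finset.card_univ]
  by_cases hi : τ.image c = Finset.univ.erase i₀
  · have hcard : τ.card = (τ.image c).card + 1 := by rw [hi, herase, hτ.1]
    obtain ⟨a, ha, hea⟩ := Finset.exists_image_erase_eq hcard
    obtain ⟨b, hb, hba, -, hab⟩ := Finset.exists_image_erase_eq_iff hcard ha hea
    have : (doors r c i₀).filter (· ⊆ τ) = {τ.erase a, τ.erase b} := by
      ext δ
      simp only [doors, Finset.mem_filter, Finset.mem_univ, true_and, Finset.mem_insert,
        Finset.mem_singleton]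
      constructor
      · rintro ⟨⟨hδ, -, hδc⟩, hsub⟩
        obtain ⟨x, hx, rfl⟩ : ∃ x ∈ τ, δ = τ.erase x := by
          obtain ⟨x, hx, h⟩ := Finset.exists_eq_insert_iff.2 ⟨hsub, by omega⟩
          exact ⟨x, by simp [← h], by simp [← h, hx]⟩
        rcases (hab x hx).1 (hδc.trans hi.symm) with rfl | rfl <;> simp
      · have hdoor : ∀ x ∈ τ, (x = a ∨ x = b) → ((τ.erase x).card + 1 = Fintype.card ι ∧
            Dominant r (τ.erase x) ∧ (τ.erase x).image c = Finset.univ.erase i₀) ∧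
              τ.erase x ⊆ τ := fun x hx hxab =>
          ⟨⟨by rw [Finset.card_erase_add_one hx, hτ.1], hτ.2.mono (Finset.erase_subset _ _),
            ((hab x hx).2 hxab).trans hi⟩, Finset.erase_subset _ _⟩
        rintro (rfl | rfl)
        exacts [hdoor a ha (.inl rfl), hdoor b hb (.inr rfl)]
    rw [this, Finset.card_pair fun h => hba ?_]
    · exact even_two
    · by_contra hne
      have : b ∈ τ.erase a := Finset.mem_erase.2 ⟨hne, hb⟩
      rw [h] at this
      simp at this
  · rw [Finset.filter_false_of_mem, Finset.card_empty]
    · exact Even.zero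
    · intro δ hδ hsub
      simp only [doors, Finset.mem_filter_univ] at hδ
      have h1 : Finset.univ.erase i₀ ⊆ τ.image c := hδ.2.2 ▸ Finset.image_subset_image hsub
      by_cases h0 : i₀ ∈ τ.image c
      · refine hc (Finset.eq_univ_of_forall fun i => ?_)
        by_cases hii : i = i₀
        · exact hii ▸ h0
        · exact h1 (by simp [hii])
      · refine hi (subset_antisymm (fun i hi' => ?_) h1)
        simp only [Finset.mem_erase, Finset.mem_univ, and_true]
        rintro rfl
        exact h0 hi'

/-- The rooms above a door are obtained by pivoting at one of two orders `a`, `b`, and one may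
prescribe `a` among the orders whose minimum is attained twice. -/
theorem mem_rooms_above_iff (hr : ∀ i, Function.Injective (r i)) {δ : Finset X}
    (hδ : Dominant r δ) (hcard : δ.card + 1 = Fintype.card ι) {m : ι → X} (hm : ∀ i, m i ∈ δ)
    (hmin : ∀ i, ∀ x ∈ δ, r i (m i) ≤ r i x) {a : ι} (ha : (Finset.univ.erase a).image m = δ) :
    ∃ b, b ≠ a ∧ m b = m a ∧ (∀ z, IsPivot r m a z ∨ IsPivot r m b z → z ∉ δ) ∧
      ∀ τ, τ ∈ (rooms r).filter (δ ⊆ ·) ↔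
        ∃ z, (IsPivot r m a z ∨ IsPivot r m b z) ∧ τ = insert z δ := by
  have himg := hδ.image_min hr hm hmin
  obtain ⟨b, -, hba, hmb, hab⟩ := Finset.exists_image_erase_eq_iff (s := Finset.univ) (f := m)
    (by rw [himg, hcard, Finset.card_univ]) (Finset.mem_univ a) (ha.trans himg.symm)
  simp only [himg, Finset.mem_univ, true_implies] at hab
  have hins := dominant_insert_iff hr hδ hcard hm hmin
  simp only [hab, or_and_right, exists_or, exists_eq_left] at hins
  refine ⟨b, hba, hmb, fun z hz => ((hins z).2 hz).1, fun τ => ?_⟩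
  simp only [rooms, Finset.mem_filter, Finset.mem_univ, true_and]
  constructor
  · rintro ⟨⟨hτ, hdom⟩, hsub⟩
    obtain ⟨z, hz, rfl⟩ := Finset.exists_eq_insert_iff.2 ⟨hsub, by omega⟩
    exact ⟨z, (hins z).1 ⟨hz, hdom⟩, rfl⟩
  · rintro ⟨z, hp, rfl⟩
    obtain ⟨hz, hdom⟩ := (hins z).2 hp
    exact ⟨⟨by rw [Finset.card_insert_of_notMem hz, hcard], hdom⟩, Finset.subset_insert _ _⟩

theorem even_card_rooms_above (hr : ∀ i, Function.Injective (r i)) {s : ι → X}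
    (hs : ∀ i x, x ≠ s i → r i (s i) < r i x)
    (hs' : ∀ i j x, j ≠ i → x ∉ Set.range s → r i x < r i (s j))
    {δ : Finset X} (hδ : Dominant r δ) (hcard : δ.card + 1 = Fintype.card ι)
    {t : X} (ht : t ∈ δ) (hts : t ∉ Set.range s) : Even ((rooms r).filter (δ ⊆ ·)).card := by
  obtain ⟨m, hm, hmin⟩ := exists_min_on r ⟨t, ht⟩
  have himg := hδ.image_min hr hm hmin
  obtain ⟨a, -, ha⟩ := Finset.exists_image_erase_eq (s := Finset.univ) (f := m)
    (by rw [himg, hcard, Finset.card_univ])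
  obtain ⟨b, hba, -, hnot, hrooms⟩ := mem_rooms_above_iff hr hδ hcard hm hmin (ha.trans himg)
  have hpiv : ∀ i, ∃ z, IsPivot r m i z := fun i => by
    refine exists_isPivot (z := s i) fun j hji => ?_
    by_cases hmj : m j ∈ Set.range s
    · obtain ⟨l, hl⟩ := hmj
      have hlj : l = j := by
        by_contra hne
        have h1 := hs' j l t hne hts
        have h2 := hmin j t ht
        rw [← hl] at h2
        omega
      subst hlj
      rw [← hl]
      refine hs l _ fun h => ?_
      have h1 := hs' l i t (Ne.symm hji) hts
      have h2 := hs l t fun h => hts ⟨l, h.symm⟩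
      rw [h] at h1
      omega
    · exact hs' j i _ (Ne.symm hji) hmj
  obtain ⟨z, hz⟩ := hpiv a
  obtain ⟨w, hw⟩ := hpiv b
  have hzw : z ≠ w := by
    rintro rfl
    obtain ⟨l, hl⟩ := hδ z
    have := hl _ (hm l)
    by_cases hla : l = a
    · have := hw.1 l (hla ▸ hba.symm)
      omega
    · have := hz.1 l hla
      omega
  have : (rooms r).filter (δ ⊆ ·) = {insert z δ, insert w δ} := by
    ext τ
    rw [hrooms, Finset.mem_insert, Finset.mem_singleton]
    constructor
    · rintro ⟨v, hva | hvb, rfl⟩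
      · exact .inl (by rw [hva.eq hr hz])
      · exact .inr (by rw [hvb.eq hr hw])
    · rintro (rfl | rfl)
      exacts [⟨z, .inl hz, rfl⟩, ⟨w, .inr hw, rfl⟩]
  rw [this, Finset.card_pair fun h => hzw ((Finset.insert_inj (hnot z (.inl hz))).1 h)]
  exact even_two


theorem card_rooms_above_slack (hr : ∀ i, Function.Injective (r i)) {s : ι → X}
    (hs : ∀ i x, x ≠ s i → r i (s i) < r i x)
    (hs' : ∀ i j x, j ≠ i → x ∉ Set.range s → r i x < r i (s j))
    (hinj : Function.Injective s) (i₀ : ι) [Nontrivial ι]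
    (hδ : Dominant r ((Finset.univ.erase i₀).image s)) {t : X} (hts : t ∉ Set.range s) :
    ((rooms r).filter ((Finset.univ.erase i₀).image s ⊆ ·)).card = 1 := by
  set δ := (Finset.univ.erase i₀).image s with hδdef
  have hcard : δ.card + 1 = Fintype.card ι := by
    rw [hδdef, Finset.card_image_of_injective _ hinj,
      Finset.card_erase_add_one (Finset.mem_univ _), Finset.card_univ]
  have hsδ : ∀ j, j ≠ i₀ → s j ∈ δ := fun j hj => Finset.mem_image_of_mem s (by simp [hj])
  obtain ⟨j₀, hj₀⟩ := exists_ne i₀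
  obtain ⟨m, hm, hmin⟩ := exists_min_on r ⟨_, hsδ j₀ hj₀⟩
  have hms : ∀ j, j ≠ i₀ → m j = s j := fun j hj => by
    by_contra h
    exact absurd (hmin j _ (hsδ j hj)) (by simpa using hs j _ h)
  have himg : (Finset.univ.erase i₀).image m = δ :=
    Finset.image_congr fun j hj => hms j (by simpa using hj)
  obtain ⟨b, hb, hmb, hnot, hrooms⟩ := mem_rooms_above_iff hr hδ hcard hm hmin himg
  obtain ⟨z, hz⟩ : ∃ z, IsPivot r m i₀ z := exists_isPivot (z := t) fun j hj => by
    rw [hms j hj]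
    exact hs j t fun h => hts ⟨j, h.symm⟩
  rw [Finset.card_eq_one]
  refine ⟨insert z δ, Finset.ext fun τ => ?_⟩
  rw [hrooms, Finset.mem_singleton]
  refine ⟨?_, fun h => ⟨z, .inl hz, h⟩⟩
  rintro ⟨v, hv | hv, rfl⟩
  · rw [hv.eq hr hz]
  · exfalso
    have hvδ := hnot v (.inr hv)
    have h0 := hv.1 i₀ hb.symm
    rw [← hmb, hms b hb] at h0
    by_cases hvs : v ∈ Set.range s
    · obtain ⟨l, rfl⟩ := hvs
      by_cases hl : l = i₀
      · subst hl
        exact absurd (hs l (s b) (hinj.ne hb)) (by omega)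
      · exact hvδ (hsδ l hl)
    · exact absurd (hs' i₀ b v hb hvs) (by omega)

/-- **Scarf's lemma**: if `s i` is the least point of the order `r i` and exceeds, in the orders
`r j` with `j ≠ i`, all points outside the range of `s`, and if `s i` has colour `i`, then some
dominant set carries every colour. -/
theorem exists_dominant_image_eq_univ [Nontrivial ι] (hr : ∀ i, Function.Injective (r i))
    {s : ι → X} (hs : ∀ i x, x ≠ s i → r i (s i) < r i x)
    (hs' : ∀ i j x, j ≠ i → x ∉ Set.range s → r i x < r i (s j))
    {c : X → ι} (hc : ∀ i, c (s i) = i) {t : X} (hts : t ∉ Set.range s) :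
    ∃ τ : Finset X, Dominant r τ ∧ τ.image c = Finset.univ := by
  classical
  by_contra! hno
  obtain ⟨i₀⟩ : Nonempty ι := inferInstance
  have hinj : Function.Injective s := Function.LeftInverse.injective hc
  set δ₀ := (Finset.univ.erase i₀).image s with hδ₀
  have hdom : Dominant r δ₀ := fun y => by
    by_cases hy : ∃ j, j ≠ i₀ ∧ y = s j
    · obtain ⟨j, -, rfl⟩ := hy
      refine ⟨j, fun x _ => ?_⟩
      by_cases hx : x = s j
      · rw [hx]
      · exact (hs j x hx).le
    · push Not at hy
      refine ⟨i₀, fun x hx => ?_⟩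
      obtain ⟨j, hj, rfl⟩ := Finset.mem_image.1 hx
      have hj' : j ≠ i₀ := by simpa using hj
      by_cases hys : y ∈ Set.range s
      · obtain ⟨l, rfl⟩ := hys
        have : l = i₀ := by
          by_contra hl
          exact hy l hl rfl
        subst this
        exact (hs l _ (hinj.ne hj')).le
      · exact (hs' i₀ j y hj' hys).le
  have hmem : δ₀ ∈ doors r c i₀ := by
    simp only [doors, Finset.mem_filter_univ]
    refine ⟨?_, hdom, ?_⟩
    · rw [hδ₀, Finset.card_image_of_injective _ hinj,
        Finset.card_erase_add_one (Finset.mem_univ _), Finset.card_univ]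
    · rw [hδ₀, Finset.image_image, show c ∘ s = id from funext hc, Finset.image_id]
  have hcount := Finset.sum_card_bipartiteAbove_eq_sum_card_bipartiteBelow
    (s := doors r c i₀) (t := rooms r) (· ⊆ ·)
  simp only [Finset.bipartiteAbove, Finset.bipartiteBelow] at hcount
  rw [← Finset.add_sum_erase _ _ hmem,
    card_rooms_above_slack hr hs hs' hinj i₀ hdom hts] at hcount
  have h1 : Even (∑ τ ∈ rooms r, ((doors r c i₀).filter (· ⊆ τ)).card) :=
    Finset.even_sum _ fun τ hτ => even_card_doors_below hτ
      (hno τ (by simp only [rooms, Finset.mem_filter_univ] at hτ; exact hτ.2))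
  have h2 : Even (∑ δ ∈ (doors r c i₀).erase δ₀, ((rooms r).filter (δ ⊆ ·)).card) := by
    refine Finset.even_sum _ fun δ hδ => ?_
    rw [Finset.mem_erase] at hδ
    simp only [doors, Finset.mem_filter_univ] at hδ
    obtain ⟨hne, hcard, hδdom, himg⟩ := hδ
    by_cases hall : ∀ x ∈ δ, x ∈ Set.range s
    · refine absurd (Finset.eq_of_subset_of_card_le (fun x hx => ?_) ?_) hne
      · obtain ⟨j, rfl⟩ := hall x hx
        have := himg ▸ Finset.mem_image_of_mem c hx
        rw [hc] at this
        exact Finset.mem_image_of_mem s this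
      · rw [hδ₀, Finset.card_image_of_injective _ hinj,
          Finset.card_erase_of_mem (Finset.mem_univ _), Finset.card_univ]
        omega
    · push Not at hall
      obtain ⟨x, hx, hxs⟩ := hall
      exact even_card_rooms_above hr hs hs' hδdom hcard hx hxs
  rw [← hcount] at h1
  exact (Nat.not_even_one ((Nat.even_add.1 h1).2 h2))

end Scarf

section Brouwer

open Filter Topology

variable {ι : Type*} [Fintype ι] [DecidableEq ι]

/-- Every colouring of the lattice points of the `N`-fold simplex admits a point `p` such that
each colour `i` occurs near `p` or the `i`-th coordinate of `p` is small. -/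
theorem exists_near_colours [Nontrivial ι] (N : ℕ) (c : (ι → ℕ) → ι) :
    ∃ p : ι → ℕ, ∑ i, p i = N ∧ ∀ i, p i ≤ Fintype.card ι ∨
      ∃ q : ι → ℕ, ∑ i, q i = N ∧ c q = i ∧
        ∀ k, q k ≤ p k + Fintype.card ι ∧ p k ≤ q k + Fintype.card ι := by
  classical
  let T := {v : ι → ℕ // v ∈ Finset.piAntidiag Finset.univ N}
  let _ : Fintype T := Finset.Subtype.fintype _
  have hT : ∀ v : T, ∑ i, v.1 i = N := fun v => (Finset.mem_piAntidiag.1 v.2).1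
  have hle : ∀ (v : T) i, v.1 i ≤ N := fun v i =>
    (Finset.single_le_sum (f := v.1) (fun _ _ => Nat.zero_le _) (Finset.mem_univ i)).trans_eq (hT v)
  have mkT : ∀ v : ι → ℕ, ∑ i, v i = N → ∃ t : T, t.1 = v := fun v hv =>
    ⟨⟨v, Finset.mem_piAntidiag.2 ⟨hv, by simp⟩⟩, rfl⟩
  set L := Fintype.card T
  let e := Fintype.equivFin T
  let e' := Fintype.equivFin ι
  let r : ι → T ⊕ ι → ℕ := fun i => Sum.elim (fun v => L * v.1 i + e v + 1)
    (fun j => if j = i then 0 else L * (N + 1) + 1 + e' j)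
  have hrT : ∀ i (v : T), r i (.inl v) = L * v.1 i + e v + 1 := fun _ _ => rfl
  have hrs : ∀ i, r i (.inr i) = 0 := fun i => if_pos rfl
  have hrne : ∀ i j, j ≠ i → r i (.inr j) = L * (N + 1) + 1 + e' j := fun i j h => if_neg h
  have hup : ∀ i (v : T), r i (.inl v) < L * (N + 1) + 1 := fun i v => by
    have := Nat.mul_le_mul_left L (hle v i)
    have := (e v).isLt
    rw [hrT, mul_add]
    omega
  have hr : ∀ i, Function.Injective (r i) := by
    intro i x y hxy
    rcases x with v | j <;> rcases y with w | l
    · rw [hrT, hrT, Nat.add_right_cancel_iff] at hxy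
      have := congrArg (· % L) hxy
      simp only [Nat.mul_add_mod] at this
      rw [Nat.mod_eq_of_lt (e v).isLt, Nat.mod_eq_of_lt (e w).isLt] at this
      rw [e.injective (Fin.ext this)]
    · have := hup i v
      by_cases hl : l = i
      · subst hl; rw [hrs, hrT] at hxy; omega
      · rw [hrne i l hl] at hxy; omega
    · have := hup i w
      by_cases hj : j = i
      · subst hj; rw [hrs, hrT] at hxy; omega
      · rw [hrne i j hj] at hxy; omega
    · by_cases hj : j = i <;> by_cases hl : l = i
      · rw [hj, hl]
      · subst hj; rw [hrs, hrne _ _ hl] at hxy; omega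
      · subst hl; rw [hrs, hrne _ _ hj] at hxy; omega
      · rw [hrne _ _ hj, hrne _ _ hl, Nat.add_left_cancel_iff] at hxy
        rw [e'.injective (Fin.ext hxy)]
  have hs : ∀ i x, x ≠ Sum.inr i → r i (.inr i) < r i x := fun i x hx => by
    rw [hrs]
    refine Nat.pos_of_ne_zero fun h => hx (hr i (h.trans (hrs i).symm))
  have hs' : ∀ i j x, j ≠ i → x ∉ Set.range (Sum.inr : ι → T ⊕ ι) → r i x < r i (.inr j) := by
    rintro i j (v | l) hj hx
    · rw [hrne i j hj]
      exact (hup i v).trans_le (Nat.le_add_right _ _)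
    · exact absurd ⟨l, rfl⟩ hx
  obtain ⟨i₁⟩ : Nonempty ι := inferInstance
  obtain ⟨t, -⟩ := mkT (Pi.single i₁ N) (by simp)
  obtain ⟨τ, hdom, hτc⟩ := exists_dominant_image_eq_univ hr hs hs'
    (c := Sum.elim (fun v => c v.1) id) (fun _ => rfl) (t := .inl t) (by simp)
  have hcol : ∀ i, ∃ x ∈ τ, Sum.elim (fun v => c v.1) id x = i := fun i =>
    Finset.mem_image.1 (by rw [hτc]; exact Finset.mem_univ i)
  obtain ⟨p, hp⟩ : ∃ p : T, Sum.inl p ∈ τ := by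
    obtain ⟨i, hi⟩ := hdom (.inl t)
    obtain ⟨x, hx, hxi⟩ := hcol i
    rcases x with v | j
    · exact ⟨v, hx⟩
    · have := hi _ hx
      simp only [Sum.elim_inr, id] at hxi
      rw [hxi, hrs, hrT] at this
      omega
  have hm : ∀ i, ∃ m : ℕ, (∀ q : T, Sum.inl q ∈ τ → m ≤ q.1 i + 1) ∧
      ((Sum.inr i ∈ τ → m = 0) ∧ (Sum.inr i ∉ τ → ∃ q : T, Sum.inl q ∈ τ ∧ m = q.1 i + 1)) := by
    intro i
    by_cases hi : Sum.inr i ∈ τ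
    · exact ⟨0, by simp, fun _ => rfl, fun h => absurd hi h⟩
    · obtain ⟨q, hq, hqm⟩ := Finset.exists_min_image
        (Finset.univ.filter fun q : T => Sum.inl q ∈ τ) (fun q => q.1 i) ⟨p, by simp [hp]⟩
      simp only [Finset.mem_filter, Finset.mem_univ, true_and] at hq hqm
      exact ⟨q.1 i + 1, fun q' hq' => Nat.succ_le_succ (hqm q' hq'), fun h => absurd h hi,
        fun _ => ⟨q, hq, rfl⟩⟩
  choose m hm hm₀ hm₁ using hm
  have hsum : N < ∑ i, m i := by
    by_contra! hle
    obtain ⟨y, hy⟩ := mkT (m + Pi.single i₁ (N - ∑ i, m i)) (by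
      simp only [Pi.add_apply, Finset.sum_add_distrib, Finset.sum_pi_single', Finset.mem_univ,
        if_true]
      omega)
    obtain ⟨i, hi⟩ := hdom (.inl y)
    by_cases hiτ : Sum.inr i ∈ τ
    · have := hi _ hiτ
      rw [hrs, hrT] at this
      omega
    · obtain ⟨q, hq, hqm⟩ := hm₁ i hiτ
      have h1 := hi _ hq
      have h2 : q.1 i + 1 ≤ y.1 i := by
        rw [hy, ← hqm]
        exact Nat.le_add_right _ _
      have h3 := Nat.mul_le_mul_left L h2
      have h4 := (e q).isLt
      rw [hrT, hrT] at h1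
      rw [mul_add] at h3
      omega
  have key : ∀ q : T, Sum.inl q ∈ τ → ∀ k, q.1 k + 1 < m k + Fintype.card ι := fun q hq k => by
    have h1 := Finset.add_sum_erase Finset.univ m (Finset.mem_univ k)
    have h2 := Finset.add_sum_erase Finset.univ (fun k => q.1 k + 1) (Finset.mem_univ k)
    have h3 : ∑ x ∈ Finset.univ.erase k, m x ≤ ∑ x ∈ Finset.univ.erase k, (q.1 x + 1) :=
      Finset.sum_le_sum fun x _ => hm x q hq
    have h4 : ∑ x, (q.1 x + 1) = N + Fintype.card ι := by
      simp [Finset.sum_add_distrib, hT q]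
    omega
  refine ⟨p.1, hT p, fun i => ?_⟩
  obtain ⟨x, hx, hxi⟩ := hcol i
  rcases x with q | j
  · refine .inr ⟨q.1, hT q, hxi, fun k => ?_⟩
    have := key p hp k
    have := key q hx k
    have := hm k p hp
    have := hm k q hx
    omega
  · simp only [Sum.elim_inr, id] at hxi
    subst hxi
    left
    have h1 := key p hp j
    rw [hm₀ j hx] at h1
    omega

/-- **Brouwer's fixed point theorem** for the standard simplex. -/
theorem exists_fixedPoint_stdSimplex [Nonempty ι] {f : (ι → ℝ) → ι → ℝ}
    (hf : ContinuousOn f (stdSimplex ℝ ι)) (hmaps : Set.MapsTo f (stdSimplex ℝ ι) (stdSimplex ℝ ι)) :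
    ∃ x ∈ stdSimplex ℝ ι, f x = x := by
  obtain ⟨i₁⟩ : Nonempty ι := inferInstance
  rcases subsingleton_or_nontrivial ι with hι | hι
  · have hx := single_mem_stdSimplex ℝ i₁
    have huniq : ∀ y ∈ stdSimplex ℝ ι, y i₁ = 1 := fun y hy => by
      rw [← hy.2, Fintype.sum_subsingleton _ i₁]
    exact ⟨_, hx, funext fun i => by
      rw [Subsingleton.elim i i₁, huniq _ (hmaps hx), huniq _ hx]⟩
  let g : ℕ → (ι → ℕ) → ι → ℝ := fun N v i => v i / ((N : ℝ) + 1)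
  have hg : ∀ N v, ∑ i, v i = N + 1 → g N v ∈ stdSimplex ℝ ι := fun N v hv => by
    refine ⟨fun i => by positivity, ?_⟩
    rw [← Finset.sum_div, ← Nat.cast_sum, hv]
    push_cast
    exact div_self (by positivity)
  have hcol : ∀ N v, ∃ i, ∑ i, v i = N + 1 → g N v i ≤ f (g N v) i := fun N v => by
    by_cases hv : ∑ i, v i = N + 1
    · obtain ⟨i, -, hi⟩ := Finset.exists_le_of_sum_le (s := Finset.univ) (f := g N v)
        (g := f (g N v)) Finset.univ_nonempty
        (by rw [(hg N v hv).2, (hmaps (hg N v hv)).2])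
      exact ⟨i, fun _ => hi⟩
    · exact ⟨i₁, fun h => absurd h hv⟩
  choose c hc using hcol
  choose p hp hpq using fun N => exists_near_colours (N + 1) (c N)
  set C : ℝ := (Fintype.card ι : ℝ) with hCdef
  have hq : ∀ N i, ∃ q ∈ stdSimplex ℝ ι, (∀ k, |q k - g N (p N) k| ≤ C / ((N : ℝ) + 1)) ∧
      q i ≤ f q i + C / ((N : ℝ) + 1) := fun N i => by
    have hN : (0 : ℝ) < (N : ℝ) + 1 := by positivity
    rcases hpq N i with h | ⟨q, hq, hqi, hqp⟩
    · refine ⟨g N (p N), hg N _ (hp N), fun k => by simp; positivity, ?_⟩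
      have h1 := (hmaps (hg N _ (hp N))).1 i
      have h2 : g N (p N) i ≤ C / ((N : ℝ) + 1) :=
        div_le_div_of_nonneg_right (by rw [hCdef]; exact_mod_cast h) hN.le
      linarith
    · refine ⟨g N q, hg N _ hq, fun k => ?_, ?_⟩
      · rw [show g N q k - g N (p N) k = ((q k : ℝ) - p N k) / ((N : ℝ) + 1) from
          (sub_div _ _ _).symm, abs_div, abs_of_pos hN]
        refine div_le_div_of_nonneg_right ?_ hN.le
        have h1 : (q k : ℝ) ≤ p N k + C := by rw [hCdef]; exact_mod_cast (hqp k).1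
        have h2 : (p N k : ℝ) ≤ q k + C := by rw [hCdef]; exact_mod_cast (hqp k).2
        rw [abs_le]
        constructor <;> linarith
      · have := hc N q hq
        rw [hqi] at this
        have : 0 ≤ C / ((N : ℝ) + 1) := by positivity
        linarith
  choose q hqS hqp hqf using hq
  obtain ⟨x, hx, φ, hφ, hlim⟩ :=
    (isCompact_stdSimplex ℝ ι).tendsto_subseq fun N => hg N _ (hp N)
  have hC : Tendsto (fun N : ℕ => C / ((φ N : ℝ) + 1)) atTop (𝓝 0) :=
    by simpa [div_eq_mul_inv] using
      (tendsto_one_div_add_atTop_nhds_zero_nat.comp hφ.tendsto_atTop).const_mul C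
  have hqlim : ∀ i, Tendsto (fun N => q (φ N) i) atTop (𝓝 x) := fun i => by
    refine tendsto_pi_nhds.2 fun k => ?_
    have h1 := squeeze_zero_norm
      (f := fun N => q (φ N) i k - g (φ N) (p (φ N)) k) (fun N => hqp (φ N) i k) hC
    simpa using h1.add ((tendsto_pi_nhds.1 hlim) k)
  have hle : ∀ i, x i ≤ f x i := fun i => by
    have h1 : Tendsto (fun N => f (q (φ N) i)) atTop (𝓝 (f x)) :=
      (hf x hx).tendsto.comp (tendsto_nhdsWithin_iff.2
        ⟨hqlim i, Eventually.of_forall fun N => hqS (φ N) i⟩)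
    have h2 := ((tendsto_pi_nhds.1 h1) i).add hC
    rw [add_zero] at h2
    exact le_of_tendsto_of_tendsto' ((tendsto_pi_nhds.1 (hqlim i)) i) h2 fun N => hqf (φ N) i
  refine ⟨x, hx, funext fun i => ?_⟩
  exact (((Finset.sum_eq_sum_iff_of_le fun i _ => hle i).1
    (by rw [hx.2, (hmaps hx).2])) i (Finset.mem_univ i)).symm

end Brouwer

theorem continuous_tmul {n k : ℕ} (A : (Fin (k + 2) → Fin n) → ℝ) (i : Fin n) :
    Continuous fun x => tmul A x i := by
  unfold tmul
  fun_prop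

theorem SemiPosOn.sZeroOn {n k : ℕ} {A : (Fin (k + 2) → Fin n) → ℝ} {J : Finset (Fin n)}
    (hJ : J.Nonempty) (hA : SemiPosOn A J) : SZeroOn A J := by
  obtain ⟨j₀, hj₀⟩ := hJ
  have : Nonempty (Fin n) := ⟨j₀⟩
  let ρ : (Fin n → ℝ) → Fin n → ℝ := fun x i =>
    (if i ∈ J then x i else 0) + if i = j₀ then ∑ l ∈ Jᶜ, x l else 0
  let g : (Fin n → ℝ) → Fin n → ℝ := fun x i => if i ∈ J then max 0 (-tmul A (ρ x) i) else 0
  let f : (Fin n → ℝ) → Fin n → ℝ := fun x i => (ρ x i + g x i) / (1 + ∑ l, g x l)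
  have hρ : Continuous ρ := by
    refine continuous_pi fun i => Continuous.add ?_ ?_ <;> split_ifs <;> fun_prop
  have hg : Continuous g := by
    refine continuous_pi fun i => ?_
    simp only [g]
    split_ifs
    · exact continuous_const.max ((continuous_tmul A i).comp hρ).neg
    · exact continuous_const
  have hg0 : ∀ x i, 0 ≤ g x i := fun x i => by
    simp only [g]
    split_ifs
    exacts [le_max_left _ _, le_rfl]
  have hs0 : ∀ x, 0 ≤ ∑ l, g x l := fun x => Finset.sum_nonneg fun i _ => hg0 x i
  have hf : Continuous f := by
    refine continuous_pi fun i => Continuous.div ?_ ?_ fun x => ?_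
    · exact ((continuous_apply i).comp hρ).add ((continuous_apply i).comp hg)
    · exact continuous_const.add (continuous_finsetSum _ fun l _ => (continuous_apply l).comp hg)
    · have := hs0 x
      positivity
  have hρ0 : ∀ x ∈ stdSimplex ℝ (Fin n), ∀ i, 0 ≤ ρ x i := fun x hx i => by
    have := hx.1 i
    have : 0 ≤ ∑ l ∈ Jᶜ, x l := Finset.sum_nonneg fun l _ => hx.1 l
    simp only [ρ]
    split_ifs <;> positivity
  have hρ1 : ∀ x ∈ stdSimplex ℝ (Fin n), ∑ i, ρ x i = 1 := fun x hx => by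
    simp only [ρ, Finset.sum_add_distrib, Finset.sum_ite_mem, Finset.univ_inter,
      Finset.sum_ite_eq', Finset.mem_univ, if_true]
    rw [Finset.sum_add_sum_compl, hx.2]
  have hρJ : ∀ x i, i ∉ J → ρ x i = 0 := fun x i hi => by
    have : i ≠ j₀ := fun h => hi (h ▸ hj₀)
    simp [ρ, hi, this]
  have hmaps : Set.MapsTo f (stdSimplex ℝ (Fin n)) (stdSimplex ℝ (Fin n)) := fun x hx => by
    have := hs0 x
    refine ⟨fun i => div_nonneg (add_nonneg (hρ0 x hx i) (hg0 x i)) (by positivity), ?_⟩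
    rw [← Finset.sum_div, Finset.sum_add_distrib, hρ1 x hx]
    exact div_self (by positivity)
  obtain ⟨x, hx, hfx⟩ := exists_fixedPoint_stdSimplex hf.continuousOn hmaps
  have hs := hs0 x
  have hxJ : ∀ i, i ∉ J → x i = 0 := fun i hi => by
    rw [← hfx]
    simp [f, g, hρJ x i hi, hi]
  have hρx : ρ x = x := funext fun i => by
    have h0 : ∑ l ∈ Jᶜ, x l = 0 :=
      Finset.sum_eq_zero fun l hl => hxJ l (Finset.mem_compl.1 hl)
    by_cases hi : i ∈ J
    · simp [ρ, hi, h0]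
    · simp [ρ, hi, h0, hxJ i hi]
  have hfix : ∀ i, g x i = x i * ∑ l, g x l := fun i => by
    have h := congrFun hfx i
    simp only [f, hρx] at h
    rw [div_eq_iff (by positivity)] at h
    linarith
  have hx0 : x ≠ 0 := by
    rintro rfl
    simpa using hx.2
  obtain ⟨j, hj, hAj⟩ := hA x hx.1 hxJ hx0
  have hgj : g x j = 0 := by
    simp only [g, hρx]
    split_ifs
    exacts [max_eq_left (by linarith), rfl]
  have hsum : ∑ l, g x l = 0 := by
    have := hfix j
    rw [hgj] at this
    exact (mul_eq_zero.1 this.symm).resolve_left hj.ne'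
  refine ⟨x, hx.1, hxJ, hx0, fun i hi => ?_⟩
  have h1 := hfix i
  rw [hsum, mul_zero] at h1
  simp only [g, hi, if_true, hρx] at h1
  have := le_max_right 0 (-tmul A x i)
  linarith

open Classical in
/-- The diagonal tensor with diagonal `d`. -/
noncomputable def diagTensor {n k : ℕ} (d : Fin n → ℝ) (g : Fin (k + 2) → Fin n) : ℝ :=
  if g = fun _ => g 0 then d (g 0) else 0

theorem tmul_add_diagTensor {n k : ℕ} (A : (Fin (k + 2) → Fin n) → ℝ) (d x : Fin n → ℝ)
    (i : Fin n) :
    tmul (fun g => A g + diagTensor d g) x i = tmul A x i + d i * x i ^ (k + 1) := by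
  simp only [tmul, add_mul, Finset.sum_add_distrib, add_right_inj]
  have hcons : ∀ f : Fin (k + 1) → Fin n,
      ((Fin.cons i f : Fin (k + 2) → Fin n) = fun _ => i) ↔ f = fun _ => i := fun f => by
    constructor
    · exact fun h => funext fun j => by simpa using congrFun h j.succ
    · rintro rfl
      exact funext fun j => by refine Fin.cases ?_ (fun _ => ?_) j <;> simp
  rw [Finset.sum_eq_single fun _ => i]
  · simp [diagTensor, (hcons _).2 rfl]
  · intro f _ hf
    simp [diagTensor, hcons, hf]
  · simp

/-- for an almost semi-positive tensor `A` there is a diagonal tensor `D`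
with positive diagonal entries such that `A + D` is almost strictly semi-positive and a
completely S₀-tensor. -/
theorem stmt_15 {n k : ℕ} (hn : 2 ≤ n) (A : (Fin (k + 2) → Fin n) → ℝ)
    (hA : AlmostSemiPos A) :
    ∃ D : (Fin (k + 2) → Fin n) → ℝ, IsDiagTensor D ∧ (∀ i : Fin n, 0 < D (fun _ => i)) ∧
      AlmostStrictSemiPos (fun g => A g + D g) ∧
        CompletelySZero (fun g => A g + D g) := by
  obtain ⟨hJ, x, hx, hAx⟩ := hA
  let d : Fin n → ℝ := fun i => -tmul A x i / x i ^ (k + 1)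
  have hd : ∀ i, 0 < d i := fun i => div_pos (neg_pos.2 (hAx i)) (pow_pos (hx i) _)
  have hzero : ∀ i, tmul (fun g => A g + diagTensor d g) x i = 0 := fun i => by
    rw [tmul_add_diagTensor, div_mul_cancel₀ _ (pow_pos (hx i) _).ne', add_neg_cancel]
  have hstrict : ∀ J : Finset (Fin n), J.Nonempty → J ≠ Finset.univ →
      StrictSemiPosOn (fun g => A g + diagTensor d g) J := fun J hne hJu y hy hyJ hy0 => by
    obtain ⟨j, hj, hAj⟩ := hJ J hne hJu y hy hyJ hy0
    refine ⟨j, hj, ?_⟩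
    rw [tmul_add_diagTensor]
    exact add_pos_of_nonneg_of_pos hAj (mul_pos (hd j) (pow_pos hj _))
  refine ⟨diagTensor d, ?_, fun i => by simpa [diagTensor] using hd i,
    ⟨hstrict, x, hx, fun i => (hzero i).le⟩, fun J hne => ?_⟩
  · rintro g ⟨j, j', hjj⟩
    refine if_neg fun h => hjj ?_
    rw [congrFun h j, congrFun h j']
  · by_cases hJu : J = Finset.univ
    · refine ⟨x, fun i => (hx i).le, fun i hi => absurd (hJu ▸ Finset.mem_univ i) hi, ?_,
        fun i _ => (hzero i).ge⟩
      obtain ⟨i, -⟩ := hne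
      exact fun h => (hx i).ne' (congrFun h i)
    · refine SemiPosOn.sZeroOn hne fun y hy hyJ hy0 => ?_
      obtain ⟨j, hj, hAj⟩ := hstrict J hne hJu y hy hyJ hy0
      exact ⟨j, hj, hAj.le⟩
end

section
/- Let 𝒜 be a symmetric real tensor of order m ≥ 2 and dimension n ≥ 2. Then 𝒜 is almost semi-positive if and only if 𝒜 is almost copositive. -/
/-- The homogeneous form `A x^m` of an order-`m = k+2` tensor. -/
def tpow {n k : ℕ} (A : (Fin (k + 2) → Fin n) → ℝ) (x : Fin n → ℝ) : ℝ :=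
  ∑ g : Fin (k + 2) → Fin n, A g * ∏ j, x (g j)

/-- `A` is symmetric: invariant under every permutation of the indices. -/
def SymTensor {n k : ℕ} (A : (Fin (k + 2) → Fin n) → ℝ) : Prop :=
  ∀ (g : Fin (k + 2) → Fin n) (σ : Equiv.Perm (Fin (k + 2))), A (g ∘ σ) = A g

/-- `A` is copositive. -/
def Copos {n k : ℕ} (A : (Fin (k + 2) → Fin n) → ℝ) : Prop :=
  ∀ x : Fin n → ℝ, (∀ i, 0 ≤ x i) → 0 ≤ tpow A x

/-- The principal subtensor of `A` indexed by `J` is copositive. -/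
def CoposOn {n k : ℕ} (A : (Fin (k + 2) → Fin n) → ℝ) (J : Finset (Fin n)) : Prop :=
  ∀ x : Fin n → ℝ, (∀ i, 0 ≤ x i) → (∀ i, i ∉ J → x i = 0) → 0 ≤ tpow A x

/-- `A` is almost copositive. -/
def AlmostCopos {n k : ℕ} (A : (Fin (k + 2) → Fin n) → ℝ) : Prop :=
  ¬ Copos A ∧ ∀ J : Finset (Fin n), J.Nonempty → J ≠ Finset.univ → CoposOn A J

theorem tpow_eq_sum_mul_tmul {n k : ℕ} (A : (Fin (k + 2) → Fin n) → ℝ) (x : Fin n → ℝ) :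
    tpow A x = ∑ i, x i * tmul A x i := by
  unfold tpow tmul
  rw [← (Fin.consEquiv fun _ : Fin (k + 2) => Fin n).sum_comp, Fintype.sum_prod_type]
  refine Finset.sum_congr rfl fun i _ => ?_
  rw [Finset.mul_sum]
  refine Finset.sum_congr rfl fun f _ => ?_
  simp only [Fin.consEquiv, Equiv.coe_fn_mk, Fin.prod_univ_succ (n := k + 1), Fin.cons_zero,
    Fin.cons_succ]
  ring

theorem tpow_smul {n k : ℕ} (A : (Fin (k + 2) → Fin n) → ℝ) (c : ℝ) (x : Fin n → ℝ) :
    tpow A (c • x) = c ^ (k + 2) * tpow A x := by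
  simp only [tpow, Pi.smul_apply, smul_eq_mul, Finset.prod_mul_distrib, Finset.prod_const,
    Finset.card_univ, Fintype.card_fin, Finset.mul_sum]
  exact Finset.sum_congr rfl fun _ _ => by ring

theorem continuous_tpow {n k : ℕ} (A : (Fin (k + 2) → Fin n) → ℝ) : Continuous (tpow A) := by
  unfold tpow
  fun_prop

theorem SymTensor.sum_insertNth {n k : ℕ} {A : (Fin (k + 2) → Fin n) → ℝ} (hA : SymTensor A)
    (x v : Fin n → ℝ) (j : Fin (k + 2)) :
    ∑ g : Fin (k + 2) → Fin n, A g * ((∏ l ∈ Finset.univ.erase j, x (g l)) * v (g j)) =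
      ∑ i, v i * tmul A x i := by
  unfold tmul
  rw [← (Fin.insertNthEquiv (fun _ : Fin (k + 2) => Fin n) j).sum_comp, Fintype.sum_prod_type]
  refine Finset.sum_congr rfl fun i _ => ?_
  rw [Finset.mul_sum]
  refine Finset.sum_congr rfl fun f _ => ?_
  have hcons : A (j.insertNth i f) = A (Fin.cons i f) := by
    rw [← Fin.cons_comp_cycleRange, hA]
  have hprod : ∏ l ∈ Finset.univ.erase j, x (j.insertNth (α := fun _ => Fin n) i f l) =
      ∏ l, x (f l) := by
    rw [Fin.univ_succAbove _ j, Finset.erase_cons, Finset.prod_map]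
    simp
  simp only [Fin.insertNthEquiv, Equiv.coe_fn_mk, Fin.insertNth_apply_same, hprod, hcons]
  ring

theorem SymTensor.hasDerivAt_tpow {n k : ℕ} {A : (Fin (k + 2) → Fin n) → ℝ} (hA : SymTensor A)
    (x v : Fin n → ℝ) :
    HasDerivAt (fun t : ℝ => tpow A (x + t • v)) ((k + 2) * ∑ i, v i * tmul A x i) 0 := by
  have hline (i : Fin n) : HasDerivAt (fun t : ℝ => (x + t • v) i) (v i) 0 := by
    simpa using ((hasDerivAt_id (0 : ℝ)).mul_const (v i)).const_add (x i)
  have hsum : HasDerivAt (fun t : ℝ => tpow A (x + t • v)) _ 0 :=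
    HasDerivAt.fun_sum fun g _ =>
      (HasDerivAt.fun_finsetProd (u := Finset.univ) fun l _ => hline (g l)).const_mul (A g)
  convert hsum using 1
  simp only [zero_smul, add_zero, smul_eq_mul]
  rw [Finset.sum_congr rfl fun g _ => Finset.mul_sum _ _ (A g), Finset.sum_comm,
    Finset.sum_congr rfl fun j _ => hA.sum_insertNth x v j]
  simp

/-- A minimiser of `A x^m` on a face of the standard simplex on which the form takes a negative
value. -/
theorem SymTensor.exists_tmul_neg_of_not_coposOn {n k : ℕ} {A : (Fin (k + 2) → Fin n) → ℝ}
    (hA : SymTensor A) {J : Finset (Fin n)} (hJ : ¬ CoposOn A J) :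
    ∃ x : Fin n → ℝ, (∀ i, 0 ≤ x i) ∧ (∀ i, i ∉ J → x i = 0) ∧ x ≠ 0 ∧ tpow A x < 0 ∧
      ∀ i, 0 < x i → tmul A x i < 0 := by
  simp only [CoposOn, not_forall, not_le] at hJ
  obtain ⟨y, hy0, hyJ, hy⟩ := hJ
  set S : Set (Fin n → ℝ) := stdSimplex ℝ (Fin n) ∩ {x | ∀ i, i ∉ J → x i = 0}
  have hclosed : IsClosed {x : Fin n → ℝ | ∀ i, i ∉ J → x i = 0} := by
    simp only [Set.ofPred_forall]
    exact isClosed_iInter fun i => isClosed_iInter fun _ =>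
      isClosed_eq (continuous_apply i) continuous_const
  have hcompact : IsCompact S := (isCompact_stdSimplex ℝ (Fin n)).inter_right hclosed
  have hzero : tpow A 0 = 0 := by simp [tpow_eq_sum_mul_tmul]
  have hnormalize (z : Fin n → ℝ) (hz0 : ∀ i, 0 ≤ z i) (hzJ : ∀ i, i ∉ J → z i = 0)
      (hz : z ≠ 0) : 0 < ∑ i, z i ∧ (∑ i, z i)⁻¹ • z ∈ S := by
    have hpos : 0 < ∑ i, z i := by
      refine (Finset.sum_nonneg fun i _ => hz0 i).lt_of_ne fun h => hz ?_
      funext i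
      exact (Finset.sum_eq_zero_iff_of_nonneg fun i _ => hz0 i).1 h.symm i (Finset.mem_univ i)
    refine ⟨hpos, ⟨fun i => mul_nonneg (inv_nonneg.2 hpos.le) (hz0 i), ?_⟩, fun i hi => ?_⟩
    · simp only [Pi.smul_apply, smul_eq_mul, ← Finset.mul_sum]
      exact inv_mul_cancel₀ hpos.ne'
    · simp [hzJ i hi]
  have hyne : y ≠ 0 := by
    rintro rfl
    exact hy.ne hzero
  obtain ⟨hypos, hyS⟩ := hnormalize y hy0 hyJ hyne
  obtain ⟨x, ⟨⟨hx0, hx1⟩, hxJ⟩, hmin⟩ :=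
    hcompact.exists_isMinOn ⟨_, hyS⟩ (continuous_tpow A).continuousOn
  have hneg : tpow A x < 0 := by
    refine (hmin hyS).trans_lt ?_
    rw [tpow_smul]
    exact mul_neg_of_pos_of_neg (by positivity) hy
  have hcone (z : Fin n → ℝ) (hz0 : ∀ i, 0 ≤ z i) (hzJ : ∀ i, i ∉ J → z i = 0) :
      tpow A x * (∑ i, z i) ^ (k + 2) ≤ tpow A z := by
    by_cases hz : z = 0
    · simp [hz, hzero]
    · obtain ⟨hpos, hzS⟩ := hnormalize z hz0 hzJ hz
      have h : tpow A x ≤ _ := hmin hzS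
      rw [tpow_smul, inv_pow, inv_mul_eq_div, le_div_iff₀ (by positivity)] at h
      exact h
  refine ⟨x, hx0, hxJ, ?_, hneg, fun i hi => ?_⟩
  · rintro rfl
    exact hneg.ne hzero
  have hiJ : i ∈ J := by
    by_contra h
    exact hi.ne' (hxJ i h)
  set e : Fin n → ℝ := Pi.single i 1 with he
  have hloc : IsLocalMin (fun t : ℝ => tpow A (x + t • e) - tpow A x * (1 + t) ^ (k + 2)) 0 := by
    filter_upwards [lt_mem_nhds (show -x i < 0 by linarith)] with t ht
    have h := hcone (x + t • e) (fun j => ?_) (fun j hj => ?_)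
    · simp only [Pi.add_apply, Pi.smul_apply, smul_eq_mul, Finset.sum_add_distrib, hx1,
        ← Finset.mul_sum, he, Finset.sum_pi_single', Finset.mem_univ, if_true, mul_one] at h
      simpa using h
    · rcases eq_or_ne j i with rfl | hji
      · simp [he]
        linarith
      · simpa [he, hji] using hx0 j
    · have hji : j ≠ i := fun h => hj (h ▸ hiJ)
      simp [he, hji, hxJ j hj]
  have hpow : HasDerivAt (fun t : ℝ => tpow A x * (1 + t) ^ (k + 2)) (tpow A x * (k + 2)) 0 := by
    simpa using ((((hasDerivAt_id (0 : ℝ)).const_add 1).pow (k + 2)).const_mul (tpow A x))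
  have hderiv := hloc.hasDerivAt_eq_zero ((hA.hasDerivAt_tpow x e).sub hpow)
  have hval : ∑ j, e j * tmul A x j = tmul A x i := by
    simp [he, Pi.single_apply]
  rw [hval, mul_comm (tpow A x), ← mul_sub] at hderiv
  have hk : (k + 2 : ℝ) ≠ 0 := by positivity
  have := (mul_eq_zero.1 hderiv).resolve_left hk
  linarith

theorem tpow_neg_of_tmul_neg {n k : ℕ} {A : (Fin (k + 2) → Fin n) → ℝ} {x : Fin n → ℝ}
    (hx0 : ∀ i, 0 ≤ x i) (hx : x ≠ 0) (h : ∀ i, 0 < x i → tmul A x i < 0) : tpow A x < 0 := by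
  obtain ⟨i, hi⟩ := Function.ne_iff.1 hx
  rw [tpow_eq_sum_mul_tmul]
  refine Finset.sum_neg' (fun j _ => ?_) ⟨i, Finset.mem_univ i, ?_⟩
  · rcases (hx0 j).eq_or_lt with hj | hj
    · simp [← hj]
    · exact (mul_neg_of_pos_of_neg hj (h j hj)).le
  · have hpos : 0 < x i := (hx0 i).lt_of_ne (Ne.symm hi)
    exact mul_neg_of_pos_of_neg hpos (h i hpos)

theorem SymTensor.semiPosOn_iff_coposOn {n k : ℕ} {A : (Fin (k + 2) → Fin n) → ℝ}
    (hA : SymTensor A) (J : Finset (Fin n)) : SemiPosOn A J ↔ CoposOn A J := by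
  refine ⟨fun h => ?_, fun h x hx0 hxJ hx => ?_⟩
  · by_contra hJ
    obtain ⟨x, hx0, hxJ, hx, -, hneg⟩ := hA.exists_tmul_neg_of_not_coposOn hJ
    obtain ⟨j, hj, hj'⟩ := h x hx0 hxJ hx
    exact (hneg j hj).not_ge hj'
  · by_contra! hneg
    exact (tpow_neg_of_tmul_neg hx0 hx hneg).not_ge (h x hx0 hxJ)

/-- a symmetric tensor is almost semi-positive iff it is almost copositive. -/
theorem stmt_16 {n k : ℕ} (hn : 2 ≤ n) (A : (Fin (k + 2) → Fin n) → ℝ)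
    (hsym : SymTensor A) :
    AlmostSemiPos A ↔ AlmostCopos A := by
  simp only [AlmostSemiPos, AlmostCopos, hsym.semiPosOn_iff_coposOn]
  rw [and_comm]
  refine and_congr_left fun hproper => ⟨?_, fun hcop => ?_⟩
  · rintro ⟨x, hx, hneg⟩ hcop
    have hx' : x ≠ 0 := fun h => (hx ⟨0, by omega⟩).ne' (congrFun h _)
    exact (tpow_neg_of_tmul_neg (fun i => (hx i).le) hx' fun i _ => hneg i).not_ge
      (hcop x fun i => (hx i).le)
  · have huniv : ¬ CoposOn A Finset.univ := fun h => hcop fun x hx => h x hx (by simp)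
    obtain ⟨x, hx0, -, hx, htpow, hneg⟩ := hsym.exists_tmul_neg_of_not_coposOn huniv
    have hpos : ∀ i, 0 < x i := by
      by_contra! ⟨i, hi⟩
      have hi0 : x i = 0 := le_antisymm hi (hx0 i)
      obtain ⟨j, hj⟩ := Function.ne_iff.1 hx
      have hne : (Finset.univ.erase i).Nonempty :=
        ⟨j, Finset.mem_erase.2 ⟨fun h => hj (h ▸ hi0), Finset.mem_univ j⟩⟩
      refine htpow.not_ge (hproper _ hne (by simp [Finset.erase_eq_self]) x hx0 fun l hl => ?_)
      have hli : l = i := by simpa using hl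
      rw [hli, hi0]
    exact ⟨x, hpos, fun i => hneg i (hpos i)⟩
end
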